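/- Fix a probability measure π on Θ and a posterior distribution ω ↦ ρ_ω, and set r̄ = P[ρ_ω(r(·,ω))] and K̄ = P[K(ρ_ω,π)]. If r̄ + √( K̄/(2N) ) ≤ 1/2, then P[ ρ_ω(R) ] ≤ ( 1 + 2K̄/N )^{-1} ( r̄ + K̄/N + √( 2 K̄ r̄ (1 − r̄)/N + K̄²/N² ) ); otherwise P[ ρ_ω(R) ] ≤ r̄ + √( K̄/(2N) ). -/

import Mathlib

open MeasureTheory ProbabilityTheory

/-- `Φ_a(p) = -a⁻¹ log(1 - (1 - e^{-a}) p)` for `a ≠ 0`, and `Φ_0(p) = p`. -/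
noncomputable def Phi (a p : ℝ) : ℝ :=
  if a = 0 then p else -a⁻¹ * Real.log (1 - (1 - Real.exp (-a)) * p)

/-- `Φ_a⁻¹(q) = (1 - e^{-aq})/(1 - e^{-a})` for `a ≠ 0`, and `Φ_0⁻¹(q) = q`. -/
noncomputable def PhiInv (a q : ℝ) : ℝ :=
  if a = 0 then q else (1 - Real.exp (-(a * q))) / (1 - Real.exp (-a))

/-- Kullback–Leibler divergence `K(ρ,π) = ∫ log (dρ/dπ) dρ` (as a real number;
meaningful under `KLFin ρ π`). -/
noncomputable def KL {Θ : Type*} [MeasurableSpace Θ] (ρ π : Measure Θ) : ℝ :=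
  ∫ θ, Real.log ((ρ.rnDeriv π θ).toReal) ∂ρ

/-- Finiteness of the Kullback–Leibler divergence: `ρ ≪ π` and `log (dρ/dπ)`
is `ρ`-integrable. -/
def KLFin {Θ : Type*} [MeasurableSpace Θ] (ρ π : Measure Θ) : Prop :=
  ρ ≪ π ∧ Integrable (fun θ => Real.log ((ρ.rnDeriv π θ).toReal)) ρ

/-- The Gibbs measure `π_{exp h}` with density `exp h / π[exp h]` with respect to `π`. -/
noncomputable def Gibbs {Θ : Type*} [MeasurableSpace Θ] (π : Measure Θ) (h : Θ → ℝ) :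
    Measure Θ :=
  (ENNReal.ofReal (∫ θ, Real.exp (h θ) ∂π))⁻¹ •
    π.withDensity (fun θ => ENNReal.ofReal (Real.exp (h θ)))

/-- Empirical error rate `r(θ,ω) = N⁻¹ ∑ᵢ 1[f_θ(X_i) ≠ Y_i]`. -/
noncomputable def empErr {𝒳 𝒴 Θ : Type*} [DecidableEq 𝒴] (N : ℕ)
    (f : Θ → 𝒳 → 𝒴) (θ : Θ) (ω : Fin N → 𝒳 × 𝒴) : ℝ :=
  (N : ℝ)⁻¹ * ∑ i, if f θ (ω i).1 = (ω i).2 then 0 else 1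

/-- Expected error rate `R(θ) = N⁻¹ ∑ᵢ P[f_θ(X_i) ≠ Y_i]`. -/
noncomputable def expErr {𝒳 𝒴 Θ : Type*} [MeasurableSpace 𝒳] [MeasurableSpace 𝒴] (N : ℕ)
    (P : Measure (Fin N → 𝒳 × 𝒴)) (f : Θ → 𝒳 → 𝒴) (θ : Θ) : ℝ :=
  (N : ℝ)⁻¹ * ∑ i, (P {ω | f θ (ω i).1 ≠ (ω i).2}).toReal

/-- A second-order bound on the cumulant generating function of a Bernoulli variable of mean `q`,
in terms of a bound `v` on the variances of the tilted variables. -/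
lemma log_one_sub_mul_one_sub_exp_le {q v a : ℝ} (hq0 : 0 ≤ q) (hq1 : q ≤ 1)
    (hv : ∀ x, 0 ≤ x → x ≤ q → x * (1 - x) ≤ v) (ha : 0 ≤ a) :
    Real.log (1 - (1 - Real.exp (-a)) * q) ≤ -(a * q) + v * a ^ 2 / 2 := by
  let D : ℝ → ℝ := fun t => 1 - (1 - Real.exp (-t)) * q
  have hD : ∀ t, 0 < D t := fun t => by
    have := Real.exp_pos (-t)
    rcases hq1.lt_or_eq with h | h
    · have := mul_nonneg this.le hq0
      simp only [D]; nlinarith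
    · simp only [D, h]; linarith
  have hexp : ∀ t : ℝ, HasDerivAt (fun s => Real.exp (-s)) (-Real.exp (-t)) t := fun t => by
    simpa using (hasDerivAt_neg t).exp
  have hDd : ∀ t, HasDerivAt D (-(Real.exp (-t) * q)) t := fun t => by
    have := (((hexp t).const_sub 1).mul_const q).const_sub 1
    exact this.congr_deriv (by ring)
  let T : ℝ → ℝ := fun t => Real.exp (-t) * q / D t
  have hTd : ∀ t, HasDerivAt T (-(T t * (1 - T t))) t := fun t => by
    have := ((hexp t).mul_const q).div (hDd t) (hD t).ne'
    refine this.congr_deriv ?_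
    have := (hD t).ne'
    simp only [T]
    field_simp
    ring
  have hT : ∀ t, 0 ≤ t → 0 ≤ T t ∧ T t ≤ q := fun t ht => by
    have he := Real.exp_pos (-t)
    have he1 : Real.exp (-t) ≤ 1 := Real.exp_le_one_iff.2 (by linarith)
    refine ⟨div_nonneg (by positivity) (hD t).le, ?_⟩
    rw [div_le_iff₀ (hD t)]
    have : 0 ≤ q * ((1 - q) * (1 - Real.exp (-t))) :=
      mul_nonneg hq0 (mul_nonneg (by linarith) (by linarith))
    simp only [D]; nlinarith
  let G : ℝ → ℝ := fun t => v * t - q + T t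
  have hGd : ∀ t, HasDerivAt G (v - T t * (1 - T t)) t := fun t => by
    have := (((hasDerivAt_id t).const_mul v).sub_const q).add (hTd t)
    exact this.congr_deriv (by ring)
  have hGmono : MonotoneOn G (Set.Ici 0) := by
    refine monotoneOn_of_deriv_nonneg (convex_Ici 0)
      (fun t _ => (hGd t).continuousAt.continuousWithinAt)
      (fun t _ => (hGd t).differentiableAt.differentiableWithinAt) fun t ht => ?_
    rw [interior_Ici, Set.mem_Ioi] at ht
    rw [(hGd t).deriv]
    have := hv _ (hT t ht.le).1 (hT t ht.le).2
    linarith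
  let H : ℝ → ℝ := fun t => v * t ^ 2 / 2 - t * q - Real.log (D t)
  have hHd : ∀ t, HasDerivAt H (G t) t := fun t => by
    have := ((((hasDerivAt_pow 2 t).const_mul v).div_const 2).sub
      ((hasDerivAt_id t).mul_const q)).sub ((hDd t).log (hD t).ne')
    refine this.congr_deriv ?_
    simp only [G, T]
    push_cast
    ring
  have hHmono : MonotoneOn H (Set.Ici 0) := by
    refine monotoneOn_of_deriv_nonneg (convex_Ici 0)
      (fun t _ => (hHd t).continuousAt.continuousWithinAt)
      (fun t _ => (hHd t).differentiableAt.differentiableWithinAt) fun t ht => ?_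
    rw [interior_Ici, Set.mem_Ioi] at ht
    rw [(hHd t).deriv]
    have h0 : G 0 = 0 := by simp [G, T, D]
    rw [← h0]
    exact hGmono Set.self_mem_Ici ht.le ht.le
  have := hHmono Set.self_mem_Ici ha ha
  have h0 : H 0 = 0 := by simp [H, D]
  rw [h0] at this
  simp only [H, D] at this
  linarith

lemma sq_sub_le_of_neg_log_le {p q d v : ℝ} (hq0 : 0 ≤ q) (hq1 : q ≤ 1) (hpq : p ≤ q)
    (hv0 : 0 < v) (hv : ∀ x, 0 ≤ x → x ≤ q → x * (1 - x) ≤ v)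
    (h : ∀ a, 0 ≤ a → -Real.log (1 - (1 - Real.exp (-a)) * q) ≤ a * p + d) :
    (q - p) ^ 2 ≤ 2 * v * d := by
  have ha : 0 ≤ (q - p) / v := div_nonneg (by linarith) hv0.le
  have h1 := h _ ha
  have h2 := log_one_sub_mul_one_sub_exp_le hq0 hq1 hv ha
  have h3 : (q - p) / v * (q - p) - v * ((q - p) / v) ^ 2 / 2 ≤ d := by linarith
  have h4 : (q - p) / v * (q - p) - v * ((q - p) / v) ^ 2 / 2 = (q - p) ^ 2 / (2 * v) := by
    field_simp; ring
  rw [h4, div_le_iff₀ (by positivity)] at h3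
  linarith

/-- Pinsker's inequality for Bernoulli variables, in dual form. -/
lemma le_add_sqrt_of_neg_log_le {p q d : ℝ} (hq0 : 0 ≤ q) (hq1 : q ≤ 1)
    (h : ∀ a, 0 ≤ a → -Real.log (1 - (1 - Real.exp (-a)) * q) ≤ a * p + d) :
    q ≤ p + √(d / 2) := by
  rcases le_total q p with hpq | hpq
  · linarith [Real.sqrt_nonneg (d / 2)]
  · have := sq_sub_le_of_neg_log_le (v := 1 / 4) hq0 hq1 hpq (by norm_num)
      (fun x _ _ => by nlinarith [sq_nonneg (x - 1 / 2)]) h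
    have := Real.le_sqrt_of_sq_le (x := q - p) (y := d / 2) (by linarith)
    linarith

lemma le_inv_mul_add_sqrt_of_neg_log_le {p q d : ℝ} (hq0 : 0 ≤ q) (hp0 : 0 ≤ p) (hd : 0 ≤ d)
    (hpd : p + √(d / 2) ≤ 1 / 2) (hq1 : q ≤ 1)
    (h : ∀ a, 0 ≤ a → -Real.log (1 - (1 - Real.exp (-a)) * q) ≤ a * p + d) :
    q ≤ (1 + 2 * d)⁻¹ * (p + d + √(2 * d * p * (1 - p) + d ^ 2)) := by
  have hq2 : q ≤ 1 / 2 := (le_add_sqrt_of_neg_log_le hq0 hq1 h).trans hpd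
  have hp2 : p ≤ 1 / 2 := by linarith [Real.sqrt_nonneg (d / 2)]
  have key : ∀ x, (x - p) ^ 2 ≤ 2 * (x * (1 - x)) * d →
      x ≤ (1 + 2 * d)⁻¹ * (p + d + √(2 * d * p * (1 - p) + d ^ 2)) := fun x hx => by
    rw [inv_mul_eq_div, le_div_iff₀ (by positivity)]
    have := Real.le_sqrt_of_sq_le (x := x * (1 + 2 * d) - (p + d))
      (y := 2 * d * p * (1 - p) + d ^ 2) (by nlinarith)
    linarith
  rcases le_or_gt q p with hpq | hpq
  · refine hpq.trans (key p ?_)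
    have : 0 ≤ p * (1 - p) * d := mul_nonneg (mul_nonneg hp0 (by linarith)) hd
    nlinarith
  · refine key q (sq_sub_le_of_neg_log_le hq0 hq1 hpq.le
      (mul_pos (by linarith) (by linarith)) (fun x _ hx => ?_) h)
    nlinarith

/-- A linearized form of the Donsker–Varadhan inequality. -/
lemma integral_le_KL_add_integral_exp_sub_one {Θ : Type*} [MeasurableSpace Θ]
    {ρ π : Measure Θ} [IsProbabilityMeasure ρ] [IsProbabilityMeasure π] (hρ : KLFin ρ π)
    {h : Θ → ℝ} (hi : Integrable h ρ) (he : Integrable (fun θ => Real.exp (h θ)) π) :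
    ∫ θ, h θ ∂ρ ≤ KL ρ π + (∫ θ, Real.exp (h θ) ∂π - 1) := by
  obtain ⟨hac, hlog⟩ := hρ
  let D : Θ → ℝ := fun θ => (ρ.rnDeriv π θ).toReal
  have hDm : Measurable D := (Measure.measurable_rnDeriv ρ π).ennreal_toReal
  have hD0 : ∀ θ, 0 ≤ D θ := fun θ => ENNReal.toReal_nonneg
  have hle : ∀ θ, D θ • (Real.exp (h θ) / D θ) ≤ Real.exp (h θ) := fun θ => by
    rcases (hD0 θ).eq_or_lt with h0 | h0
    · simp [← h0, Real.exp_nonneg]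
    · rw [smul_eq_mul, mul_div_cancel₀ _ h0.ne']
  have hint : Integrable (fun θ => D θ • (Real.exp (h θ) / D θ)) π := by
    refine he.mono' ?_ (ae_of_all _ fun θ => ?_)
    · exact hDm.aestronglyMeasurable.smul
        (he.aemeasurable.div hDm.aemeasurable).aestronglyMeasurable
    · rw [Real.norm_of_nonneg]
      · exact hle θ
      · exact mul_nonneg (hD0 θ) (div_nonneg (Real.exp_nonneg _) (hD0 θ))
  have hint' : Integrable (fun θ => Real.exp (h θ) / D θ) ρ :=
    (integrable_rnDeriv_smul_iff hac).1 hint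
  have h1 : ∫ θ, Real.exp (h θ) / D θ ∂ρ ≤ ∫ θ, Real.exp (h θ) ∂π := by
    rw [← integral_rnDeriv_smul hac]
    exact integral_mono hint he hle
  have h2 : ∫ θ, (h θ - Real.log (D θ)) ∂ρ ≤ ∫ θ, (Real.exp (h θ) / D θ - 1) ∂ρ := by
    refine integral_mono_ae (hi.sub hlog) (hint'.sub (integrable_const 1)) ?_
    filter_upwards [Measure.rnDeriv_pos hac, hac.ae_le (Measure.rnDeriv_lt_top ρ π)] with θ hp ht
    have hpos : 0 < D θ := ENNReal.toReal_pos hp.ne' ht.ne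
    have := Real.add_one_le_exp (h θ - Real.log (D θ))
    rw [Real.exp_sub, Real.exp_log hpos] at this
    linarith
  rw [integral_sub hi hlog, integral_sub hint' (integrable_const 1)] at h2
  simp only [integral_const, probReal_univ, smul_eq_mul, mul_one] at h2
  simp only [KL]
  linarith

lemma KL_nonneg {Θ : Type*} [MeasurableSpace Θ] {ρ π : Measure Θ} [IsProbabilityMeasure ρ]
    [IsProbabilityMeasure π] (hρ : KLFin ρ π) : 0 ≤ KL ρ π := by
  simpa using integral_le_KL_add_integral_exp_sub_one hρ (h := fun _ => 0)
    (integrable_const _) (integrable_const _)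

section ErrorRates

variable {𝒳 𝒴 Θ : Type*} {N : ℕ}

lemma empErr_nonneg [DecidableEq 𝒴] (f : Θ → 𝒳 → 𝒴) (θ : Θ) (ω : Fin N → 𝒳 × 𝒴) :
    0 ≤ empErr N f θ ω :=
  mul_nonneg (by positivity) (Finset.sum_nonneg fun i _ => by split_ifs <;> simp)

lemma empErr_le_one [DecidableEq 𝒴] (f : Θ → 𝒳 → 𝒴) (θ : Θ) (ω : Fin N → 𝒳 × 𝒴) :
    empErr N f θ ω ≤ 1 := by
  refine inv_mul_le_one_of_le₀ ?_ (by positivity)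
  calc _ ≤ ∑ _i : Fin N, (1 : ℝ) := Finset.sum_le_sum fun i _ => by split_ifs <;> simp
    _ = N := by simp

variable [MeasurableSpace 𝒳] [MeasurableSpace 𝒴]

lemma expErr_nonneg (P : Measure (Fin N → 𝒳 × 𝒴)) (f : Θ → 𝒳 → 𝒴) (θ : Θ) :
    0 ≤ expErr N P f θ :=
  mul_nonneg (by positivity) (Finset.sum_nonneg fun _ _ => ENNReal.toReal_nonneg)

lemma expErr_le_one (P : Measure (Fin N → 𝒳 × 𝒴)) [IsProbabilityMeasure P]
    (f : Θ → 𝒳 → 𝒴) (θ : Θ) : expErr N P f θ ≤ 1 := by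
  refine inv_mul_le_one_of_le₀ ?_ (by positivity)
  calc _ ≤ ∑ _i : Fin N, (1 : ℝ) := Finset.sum_le_sum fun i _ => measureReal_le_one
    _ = N := by simp

variable [MeasurableSpace Θ] [Finite 𝒴] [MeasurableSingletonClass 𝒴] {f : Θ → 𝒳 → 𝒴}

lemma measurableSet_eq_label (hf : Measurable fun p : Θ × 𝒳 => f p.1 p.2) (i : Fin N) :
    MeasurableSet {p : (Fin N → 𝒳 × 𝒴) × Θ | f p.2 (p.1 i).1 = (p.1 i).2} :=
  have h : Measurable fun p : (Fin N → 𝒳 × 𝒴) × Θ => (p.2, (p.1 i).1) := by fun_prop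
  measurableSet_eq_fun (hf.comp h) (by fun_prop)

lemma measurable_empErr [DecidableEq 𝒴] (hf : Measurable fun p : Θ × 𝒳 => f p.1 p.2) :
    Measurable fun p : (Fin N → 𝒳 × 𝒴) × Θ => empErr N f p.2 p.1 :=
  (Finset.measurable_fun_sum _ fun i _ =>
    Measurable.ite (measurableSet_eq_label hf i) measurable_const measurable_const).const_mul _

lemma measurable_expErr (P : Measure (Fin N → 𝒳 × 𝒴)) [SFinite P]
    (hf : Measurable fun p : Θ × 𝒳 => f p.1 p.2) : Measurable (expErr N P f) :=
  (Finset.measurable_fun_sum _ fun i _ =>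
    (measurable_measure_prodMk_right (measurableSet_eq_label hf i).compl).ennreal_toReal).const_mul _

/-- The Laplace transform of the number of errors is controlled through its mean; the tangent at
`u` of the logarithm plays the part of the concavity of `log`. -/
lemma integral_exp_tangent_sub_empErr_le_one [DecidableEq 𝒴] (hN : 0 < N)
    (Ps : Fin N → Measure (𝒳 × 𝒴))
    [∀ i, IsProbabilityMeasure (Ps i)] (hf : Measurable fun p : Θ × 𝒳 => f p.1 p.2) (θ : Θ)
    {a u : ℝ} (hu : 0 < u) :
    ∫ ω, Real.exp (N * (1 - (1 - (1 - Real.exp (-a)) * expErr N (Measure.pi Ps) f θ) / u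
      - Real.log u - a * empErr N f θ ω)) ∂(Measure.pi Ps) ≤ 1 := by
  have hN' : (N : ℝ) ≠ 0 := by positivity
  let S : Set (𝒳 × 𝒴) := {z | f θ z.1 ≠ z.2}
  have hS : MeasurableSet S :=
    (measurableSet_eq_fun (hf.comp (measurable_const.prodMk measurable_fst)) measurable_snd).compl
  let c := 1 - Real.exp (-a)
  let x : Fin N → ℝ := fun i => 1 - c * (Ps i).real S
  have hx : ∀ i, ∫ z, Real.exp (-a * if f θ z.1 = z.2 then 0 else 1) ∂(Ps i) = x i := fun i => by
    have : ∀ z : 𝒳 × 𝒴, Real.exp (-a * if f θ z.1 = z.2 then 0 else 1)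
        = 1 - c * S.indicator (fun _ => (1 : ℝ)) z := fun z => by
      by_cases hz : f θ z.1 = z.2 <;> simp [S, hz, c]
    simp_rw [this]
    rw [integral_sub (integrable_const _)
      (((integrable_const _).indicator hS).const_mul _), integral_const_mul,
      integral_indicator_const _ hS]
    simp [x]
  have hx0 : ∀ i, 0 ≤ x i := fun i => by
    rw [← hx i]
    exact integral_nonneg fun _ => Real.exp_nonneg _
  have hexpErr : ∀ i, (Measure.pi Ps {ω | f θ (ω i).1 ≠ (ω i).2}).toReal = (Ps i).real S :=
    fun i => congrArg ENNReal.toReal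
      ((measurePreserving_eval Ps i).measure_preimage hS.nullMeasurableSet)
  have hsum : (N : ℝ) * (1 - c * expErr N (Measure.pi Ps) f θ) = ∑ i, x i := by
    simp only [expErr, hexpErr, x, Finset.sum_sub_distrib, ← Finset.mul_sum]
    simp only [Finset.sum_const, Finset.card_univ, Fintype.card_fin, nsmul_eq_mul]
    field_simp
  have hsplit : ∀ ω : Fin N → 𝒳 × 𝒴,
      Real.exp (N * (1 - (1 - c * expErr N (Measure.pi Ps) f θ) / u
        - Real.log u - a * empErr N f θ ω))
      = Real.exp (∑ i, (1 - x i / u - Real.log u)) *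
        ∏ i, Real.exp (-a * if f θ (ω i).1 = (ω i).2 then 0 else 1) := fun ω => by
    rw [← Real.exp_sum, ← Real.exp_add]
    congr 1
    simp only [Finset.sum_sub_distrib, ← Finset.mul_sum, ← Finset.sum_div, ← hsum, empErr]
    simp only [Finset.sum_const, Finset.card_univ, Fintype.card_fin, nsmul_eq_mul]
    field_simp
    ring
  change ∫ ω, Real.exp (N * (1 - (1 - c * expErr N (Measure.pi Ps) f θ) / u
        - Real.log u - a * empErr N f θ ω)) ∂(Measure.pi Ps) ≤ 1
  simp_rw [hsplit]
  rw [integral_const_mul, integral_fintype_prod_eq_prod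
    (f := fun _ (z : 𝒳 × 𝒴) => Real.exp (-a * if f θ z.1 = z.2 then 0 else 1)), Real.exp_sum,
    ← Finset.prod_mul_distrib]
  simp_rw [hx]
  refine Finset.prod_le_one (fun i _ => mul_nonneg (Real.exp_nonneg _) (hx0 i)) fun i _ => ?_
  have h1 : x i / u ≤ Real.exp (x i / u - 1) := by
    linarith [Real.add_one_le_exp (x i / u - 1)]
  calc Real.exp (1 - x i / u - Real.log u) * x i
      = Real.exp (1 - x i / u) * (x i / u) := by
        rw [Real.exp_sub, Real.exp_log hu]; ring
    _ ≤ Real.exp (1 - x i / u) * Real.exp (x i / u - 1) := by gcongr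
    _ = 1 := by rw [← Real.exp_add]; simp

/-- The PAC-Bayesian inequality from which the bounds on the expected error rate follow. -/
lemma neg_log_integral_expErr_le [DecidableEq 𝒴] (hN : 0 < N)
    (Ps : Fin N → Measure (𝒳 × 𝒴))
    [∀ i, IsProbabilityMeasure (Ps i)] (hf : Measurable fun p : Θ × 𝒳 => f p.1 p.2)
    (π : Measure Θ) [IsProbabilityMeasure π]
    (ρ : Kernel (Fin N → 𝒳 × 𝒴) Θ) [IsMarkovKernel ρ]
    (hρ : ∀ᵐ ω ∂(Measure.pi Ps), KLFin (ρ ω) π)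
    (hKLint : Integrable (fun ω => KL (ρ ω) π) (Measure.pi Ps)) {a : ℝ} (ha : 0 ≤ a) :
    -Real.log (1 - (1 - Real.exp (-a)) *
        ∫ ω, (∫ θ, expErr N (Measure.pi Ps) f θ ∂(ρ ω)) ∂(Measure.pi Ps))
      ≤ a * (∫ ω, (∫ θ, empErr N f θ ω ∂(ρ ω)) ∂(Measure.pi Ps))
        + (∫ ω, KL (ρ ω) π ∂(Measure.pi Ps)) / N := by
  set P := Measure.pi Ps
  have hN' : (0 : ℝ) < N := by positivity
  let c := 1 - Real.exp (-a)
  have hc0 : 0 ≤ c := sub_nonneg.2 (Real.exp_le_one_iff.2 (by linarith))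
  have hc1 : c < 1 := sub_lt_self _ (Real.exp_pos _)
  have hR : Measurable fun p : (Fin N → 𝒳 × 𝒴) × Θ => expErr N P f p.2 :=
    (measurable_expErr P hf).comp measurable_snd
  have hr := measurable_empErr (N := N) hf
  have hRi : Integrable (fun p : (Fin N → 𝒳 × 𝒴) × Θ => expErr N P f p.2) (P ⊗ₘ ρ) :=
    Integrable.of_bound hR.aestronglyMeasurable 1 (ae_of_all _ fun p => by
      rw [Real.norm_of_nonneg (expErr_nonneg P f p.2)]; exact expErr_le_one P f p.2)
  have hri : Integrable (fun p : (Fin N → 𝒳 × 𝒴) × Θ => empErr N f p.2 p.1) (P ⊗ₘ ρ) :=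
    Integrable.of_bound hr.aestronglyMeasurable 1 (ae_of_all _ fun p => by
      rw [Real.norm_of_nonneg (empErr_nonneg f p.2 p.1)]; exact empErr_le_one f p.2 p.1)
  rw [← Measure.integral_compProd hRi, ← Measure.integral_compProd hri]
  set Rbar := ∫ p, expErr N P f p.2 ∂(P ⊗ₘ ρ) with hRbar
  set rbar := ∫ p, empErr N f p.2 p.1 ∂(P ⊗ₘ ρ) with hrbar
  have hRbar1 : Rbar ≤ 1 := by
    simpa using integral_mono hRi (integrable_const 1) fun p => expErr_le_one P f p.2
  have hu : 0 < 1 - c * Rbar := by nlinarith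
  set u := 1 - c * Rbar with hu_def
  let h : (Fin N → 𝒳 × 𝒴) × Θ → ℝ := fun p =>
    N * (1 - (1 - c * expErr N P f p.2) / u - Real.log u - a * empErr N f p.2 p.1)
  have hm : Measurable h := by fun_prop
  have hle : ∀ p, h p ≤ N * (1 - Real.log u) := fun p => by
    have h1 : 0 ≤ (1 - c * expErr N P f p.2) / u :=
      div_nonneg (by nlinarith [expErr_nonneg P f p.2, expErr_le_one P f p.2]) hu.le
    have h2 := mul_nonneg ha (empErr_nonneg f p.2 p.1)
    exact mul_le_mul_of_nonneg_left (by linarith) hN'.le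
  have hei : ∀ (μ : Measure ((Fin N → 𝒳 × 𝒴) × Θ)) [IsFiniteMeasure μ],
      Integrable (fun p => Real.exp (h p)) μ := fun μ _ =>
    Integrable.of_bound hm.exp.aestronglyMeasurable (Real.exp (N * (1 - Real.log u)))
      (ae_of_all _ fun p => by
        rw [Real.norm_of_nonneg (Real.exp_nonneg _)]; exact Real.exp_le_exp.2 (hle p))
  have hi : Integrable h (P ⊗ₘ ρ) :=
    ((((integrable_const _).sub (((integrable_const _).sub (hRi.const_mul c)).div_const u)).sub
      (integrable_const _)).sub (hri.const_mul a)).const_mul _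
  have hint : ∫ p, h p ∂(P ⊗ₘ ρ) = N * (-Real.log u - a * rbar) := by
    simp only [h]
    rw [integral_const_mul, integral_sub, integral_sub, integral_sub, integral_div, integral_sub,
      integral_const_mul, integral_const_mul, ← hRbar, ← hrbar]
    · simp only [integral_const, probReal_univ, smul_eq_mul, one_mul, ← hu_def]
      rw [div_self hu.ne']
      ring
    all_goals fun_prop
  have hexp : ∫ p, Real.exp (h p) ∂(P.prod π) ≤ 1 := by
    rw [integral_prod_symm _ (hei _)]
    calc _ ≤ ∫ _, (1 : ℝ) ∂π := integral_mono (hei (P.prod π)).integral_prod_right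
            (integrable_const 1)
            fun θ => integral_exp_tangent_sub_empErr_le_one hN Ps hf θ hu
      _ = 1 := by simp
  have hmain : ∫ ω, ∫ θ, h (ω, θ) ∂(ρ ω) ∂P
      ≤ ∫ ω, (KL (ρ ω) π + (∫ θ, Real.exp (h (ω, θ)) ∂π - 1)) ∂P := by
    have := hi.integral_compProd
    have hei' := (hei (P.prod π)).integral_prod_left
    refine integral_mono_ae this
      (hKLint.add (hei'.sub (integrable_const 1))) ?_
    filter_upwards [hρ, (hei (P.prod π)).prod_right_ae,
      ((Measure.integrable_compProd_iff hi.aestronglyMeasurable).1 hi).1] with ω h1 h2 h3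
    exact integral_le_KL_add_integral_exp_sub_one h1 h3 h2
  have hZ := (hei (P.prod π)).integral_prod_left
  rw [← Measure.integral_compProd hi, hint,
    integral_add hKLint (by exact hZ.sub (integrable_const 1)),
    integral_sub hZ (integrable_const 1), ← integral_prod _ (hei _)] at hmain
  simp only [integral_const, probReal_univ, smul_eq_mul, mul_one] at hmain
  have : -Real.log u - a * rbar ≤ (∫ ω, KL (ρ ω) π ∂P) / N := by
    rw [le_div_iff₀ hN']; linarith
  linarith

end ErrorRates

/-- Optimized unbiased empirical bound (Theorem `thm1.1.6` of Catoni): with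
`r̄ = P[ρ(r)]` and `K̄ = P[K(ρ,π)]`, if `r̄ + √(K̄/(2N)) ≤ 1/2` then
`P[ρ(R)] ≤ (1 + 2K̄/N)⁻¹ (r̄ + K̄/N + √(2K̄ r̄(1-r̄)/N + K̄²/N²))`,
and otherwise `P[ρ(R)] ≤ r̄ + √(K̄/(2N))`. -/
theorem statement_10 {𝒳 𝒴 Θ : Type*} [MeasurableSpace 𝒳] [MeasurableSpace 𝒴]
    [Fintype 𝒴] [DecidableEq 𝒴] [MeasurableSingletonClass 𝒴] [MeasurableSpace Θ]
    (N : ℕ) (hN : 0 < N)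
    (Ps : Fin N → Measure (𝒳 × 𝒴)) [∀ i, IsProbabilityMeasure (Ps i)]
    (P : Measure (Fin N → 𝒳 × 𝒴)) [IsProbabilityMeasure P] (hP : P = Measure.pi Ps)
    (f : Θ → 𝒳 → 𝒴) (hf : Measurable fun p : Θ × 𝒳 => f p.1 p.2)
    (π : Measure Θ) [IsProbabilityMeasure π]
    (ρ : Kernel (Fin N → 𝒳 × 𝒴) Θ) [IsMarkovKernel ρ]
    (hρ : ∀ᵐ ω ∂P, KLFin (ρ ω) π)
    (hKLint : Integrable (fun ω => KL (ρ ω) π) P)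
    (rbar Kbar : ℝ)
    (hrbar : rbar = ∫ ω, (∫ θ, empErr N f θ ω ∂(ρ ω)) ∂P)
    (hKbar : Kbar = ∫ ω, KL (ρ ω) π ∂P) :
    (rbar + Real.sqrt (Kbar / (2 * N)) ≤ 1 / 2 →
      ∫ ω, (∫ θ, expErr N P f θ ∂(ρ ω)) ∂P
        ≤ (1 + 2 * Kbar / N)⁻¹ *
            (rbar + Kbar / N
              + Real.sqrt (2 * Kbar * rbar * (1 - rbar) / N + Kbar ^ 2 / (N : ℝ) ^ 2)))
    ∧ (¬ (rbar + Real.sqrt (Kbar / (2 * N)) ≤ 1 / 2) →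
      ∫ ω, (∫ θ, expErr N P f θ ∂(ρ ω)) ∂P ≤ rbar + Real.sqrt (Kbar / (2 * N))) := by
  subst hP
  have hN' : (0 : ℝ) < N := by positivity
  have hq0 : 0 ≤ ∫ ω, (∫ θ, expErr N (Measure.pi Ps) f θ ∂(ρ ω)) ∂(Measure.pi Ps) :=
    integral_nonneg fun ω => integral_nonneg fun θ => expErr_nonneg _ f θ
  have hq1 : ∫ ω, (∫ θ, expErr N (Measure.pi Ps) f θ ∂(ρ ω)) ∂(Measure.pi Ps) ≤ 1 := by
    have h1 : ∀ ω, ∫ θ, expErr N (Measure.pi Ps) f θ ∂(ρ ω) ≤ 1 := fun ω => by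
      simpa using integral_mono_of_nonneg (ae_of_all (ρ ω) fun θ => expErr_nonneg _ f θ)
        (integrable_const 1) (ae_of_all _ fun θ => expErr_le_one (Measure.pi Ps) f θ)
    simpa using integral_mono_of_nonneg
      (ae_of_all (Measure.pi Ps) fun ω => integral_nonneg fun θ => expErr_nonneg _ f θ)
      (integrable_const 1) (ae_of_all _ h1)
  have hp0 : 0 ≤ rbar := hrbar ▸
    integral_nonneg fun ω => integral_nonneg fun θ => empErr_nonneg f θ ω
  have hd : 0 ≤ Kbar / N := div_nonneg
    (hKbar ▸ integral_nonneg_of_ae (hρ.mono fun ω h => KL_nonneg h)) hN'.le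
  have key := fun (a : ℝ) (ha : 0 ≤ a) =>
    neg_log_integral_expErr_le hN Ps hf π ρ hρ hKLint ha
  rw [← hrbar, ← hKbar] at key
  rw [show Kbar / (2 * N) = Kbar / N / 2 by ring,
    show 2 * Kbar / N = 2 * (Kbar / N) by ring,
    show 2 * Kbar * rbar * (1 - rbar) / N + Kbar ^ 2 / (N : ℝ) ^ 2
      = 2 * (Kbar / N) * rbar * (1 - rbar) + (Kbar / N) ^ 2 by ring]
  exact ⟨fun h => le_inv_mul_add_sqrt_of_neg_log_le hq0 hp0 hd h hq1 key,
    fun _ => le_add_sqrt_of_neg_log_le hq0 hq1 key⟩
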